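/- arXiv:1012.1072 — 3 statements merged into one kernel-verified Lean document; each statement's English description precedes it below -/
import Mathlib

section
/- Stationary reduction of the 2-site chiral flow to the elliptic top (Section 3.2): For every A = ∑_{γ∈Γ'_N} A_γ T_γ ∈ sl(N,ℂ) and every w ∈ ℂ with w ∉ Γ_τ, one has [A, ∑_{γ∈Γ'_N} A_γ φ_γ(w) φ_γ(−w) T_γ] = [A, ∑_{γ∈Γ'_N} A_γ ℘(ω_γ) T_γ]; that is, [A, φ̂_w(φ̂_{−w}(A))] = [A, ℘̂(A)]. -/
open scoped BigOperators
open Complex Matrix Finset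

noncomputable section

/-- The lattice `Γ_τ = ℤ + τℤ`. -/
def latticeGamma (τ : ℂ) : Set ℂ := {w | ∃ m n : ℤ, w = (m : ℂ) + (n : ℂ) * τ}

/-- The odd theta function `ϑ(z|τ)`. -/
def theta (τ z : ℂ) : ℂ :=
  Complex.exp (2 * (Real.pi : ℂ) * Complex.I * τ / 8) *
    ∑' m : ℤ, (-1 : ℂ) ^ m *
      Complex.exp (2 * (Real.pi : ℂ) * Complex.I * ((m : ℂ) * ((m : ℂ) + 1) * τ / 2 + (m : ℂ) * z))

/-- The first Eisenstein function `E₁(z) = ϑ'(z)/ϑ(z)`. -/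
def E1 (τ z : ℂ) : ℂ := deriv (theta τ) z / theta τ z

/-- The second Eisenstein function `E₂(z) = −E₁'(z)`. -/
def E2 (τ z : ℂ) : ℂ := -deriv (E1 τ) z

/-- The constant `η₁` determined by `E₁(z) = 1/z − 2η₁z + O(z³)` near `z = 0`. -/
def eta1 (τ : ℂ) : ℂ :=
  -(deriv (fun z : ℂ => if z = 0 then 0 else E1 τ z - 1 / z) 0) / 2

/-- The Weierstrass function `℘(z) = E₂(z) − 2η₁`. -/
def wp (τ z : ℂ) : ℂ := E2 τ z - 2 * eta1 τ

/-- The Kronecker function `φ(u,z) = ϑ(u+z)ϑ'(0)/(ϑ(u)ϑ(z))`. -/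
def kronPhi (τ u z : ℂ) : ℂ := theta τ (u + z) * deriv (theta τ) 0 / (theta τ u * theta τ z)

/-- `f(u,z) = ∂_u φ(u,z)`. -/
def kronF (τ u z : ℂ) : ℂ := deriv (fun u' => kronPhi τ u' z) u

/-- `e_N(z) = exp(2πiz/N)`. -/
def eN (N : ℕ) (z : ℂ) : ℂ := Complex.exp (2 * (Real.pi : ℂ) * Complex.I * z / N)

/-- The matrix `Q = diag(e_N(1),…,e_N(N−1),1)`. -/
def Qm (N : ℕ) : Matrix (Fin N) (Fin N) ℂ :=
  Matrix.diagonal fun i => eN N ((i : ℕ) + 1)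

/-- The cyclic shift matrix `Λ`. -/
def Lm (N : ℕ) : Matrix (Fin N) (Fin N) ℂ :=
  Matrix.of fun i j => if ((i : ℕ) + 1) % N = (j : ℕ) then 1 else 0

/-- The basis matrices `T_γ = e_N(γ₁γ₂/2) Q^{γ₁} Λ^{γ₂}` for `γ ∈ ℤ²`. -/
def Tm (N : ℕ) (γ : ℤ × ℤ) : Matrix (Fin N) (Fin N) ℂ :=
  eN N (((γ.1 * γ.2 : ℤ) : ℂ) / 2) • (Qm N ^ γ.1 * Lm N ^ γ.2)

/-- `ω_γ = (γ₁ + γ₂τ)/N`. -/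
def om (N : ℕ) (τ : ℂ) (γ : ℤ × ℤ) : ℂ := ((γ.1 : ℂ) + (γ.2 : ℂ) * τ) / N

/-- `φ_γ(z) = e_N(γ₂z) φ(ω_γ, z)`. -/
def phiG (N : ℕ) (τ : ℂ) (γ : ℤ × ℤ) (z : ℂ) : ℂ := eN N ((γ.2 : ℂ) * z) * kronPhi τ (om N τ γ) z

/-- `f_γ(z) = e_N(γ₂z) f(ω_γ, z)`. -/
def fG (N : ℕ) (τ : ℂ) (γ : ℤ × ℤ) (z : ℂ) : ℂ := eN N ((γ.2 : ℂ) * z) * kronF τ (om N τ γ) z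

/-- `F_γ(z) = φ_γ(z)E₁(z) − f_γ(z)`. -/
def FG (N : ℕ) (τ : ℂ) (γ : ℤ × ℤ) (z : ℂ) : ℂ := phiG N τ γ z * E1 τ z - fG N τ γ z

/-- A fixed set of representatives of the nonzero classes of `(ℤ/Nℤ)²`. -/
def GammaN' (N : ℕ) : Finset (ℤ × ℤ) :=
  ((Finset.range N ×ˢ Finset.range N).image fun p => ((p.1 : ℤ), (p.2 : ℤ))) \ {(0, 0)}



/-! ### Liouville for elliptic functions -/

lemma ell_indep (τ : ℂ) (hτ : 0 < τ.im) : LinearIndependent ℝ ![(1 : ℂ), τ] := by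
  rw [LinearIndependent.pair_iff]
  intro s t h
  have h2 := congrArg Complex.im h
  have h1 := congrArg Complex.re h
  simp at h1 h2
  have ht : t = 0 := by
    rcases h2 with h | h
    · exact h
    · exact absurd h hτ.ne'
  subst ht
  simpa using h1

/-- The period pair `(1, τ)`. -/
def ellPair (τ : ℂ) (hτ : 0 < τ.im) : PeriodPair := ⟨1, τ, ell_indep τ hτ⟩

lemma mem_ellPair (τ : ℂ) (hτ : 0 < τ.im) (z : ℂ) :
    z ∈ (ellPair τ hτ).lattice ↔ z ∈ latticeGamma τ := by
  rw [PeriodPair.mem_lattice]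
  simp only [ellPair, latticeGamma, Set.mem_ofPred_eq, mul_one]
  constructor
  · rintro ⟨m, n, h⟩; exact ⟨m, n, h.symm⟩
  · rintro ⟨m, n, h⟩; exact ⟨m, n, h.symm⟩

open Topology Filter in
open Classical in
lemma ell_liouville (τ : ℂ) (hτ : 0 < τ.im) (G g : ℂ → ℂ)
    (h1 : ∀ u, u ∉ latticeGamma τ → G (u + 1) = G u)
    (h2 : ∀ u, u ∉ latticeGamma τ → G (u + τ) = G u)
    (hd : ∀ u, u ∉ latticeGamma τ → DifferentiableAt ℂ G u)
    (hg : DifferentiableAt ℂ g 0) (hgG : ∀ᶠ u in 𝓝[≠] 0, G u = g u) :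
    ∃ c, ∀ u, u ∉ latticeGamma τ → G u = c := by
  set L := ellPair τ hτ with hL
  have key : ∀ u, u ∉ latticeGamma τ ↔ u ∉ L.lattice := fun u => by rw [mem_ellPair]
  simp only [key] at *
  have m1 : (1 : ℂ) ∈ L.lattice := L.ω₁_mem_lattice
  have m2 : τ ∈ L.lattice := L.ω₂_mem_lattice
  set F : ℂ → ℂ := fun u => if u ∈ L.lattice then g 0 else G u with hF
  have F1 : ∀ u, F (u + 1) = F u := by
    intro u
    by_cases hu : u ∈ L.lattice
    · simp [hF, hu, add_mem hu m1]
    · have : u + 1 ∉ L.lattice := fun h => hu (by simpa using sub_mem h m1)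
      simp [hF, hu, this, h1 u hu]
  have F2 : ∀ u, F (u + τ) = F u := by
    intro u
    by_cases hu : u ∈ L.lattice
    · simp [hF, hu, add_mem hu m2]
    · have : u + τ ∉ L.lattice := fun h => hu (by simpa using sub_mem h m2)
      simp [hF, hu, this, h2 u hu]
  have Fl : ∀ u l, l ∈ L.lattice → F (u + l) = F u := by
    intro u l hl
    obtain ⟨m, n, rfl⟩ := PeriodPair.mem_lattice.mp hl
    have p1 : Function.Periodic F 1 := F1
    have p2 : Function.Periodic F τ := F2
    have e1 := p1.int_mul m
    have e2 := p2.int_mul n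
    change F (u + (m * 1 + n * τ)) = F u
    rw [← add_assoc, e2, e1]
  have F0 : DifferentiableAt ℂ F 0 := by
    refine hg.congr_of_eventuallyEq ?_
    rw [eventually_nhdsWithin_iff] at hgG
    filter_upwards [hgG, L.compl_lattice_sdiff_singleton_mem_nhds 0] with u hu hu'
    by_cases h0 : u = 0
    · subst h0; simp [hF]
    · have : u ∉ L.lattice := by
        intro h; exact hu' ⟨h, h0⟩
      simp [hF, this, hu h0]
  have FD : Differentiable ℂ F := by
    intro u
    by_cases hu : u ∈ L.lattice
    · have e : F = fun z => F (z - u) := by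
        funext z
        have := Fl (z - u) u hu
        rw [sub_add_cancel] at this
        exact this
      rw [e]
      refine DifferentiableAt.comp (g := F) (f := fun z => z - u) u ?_ (by fun_prop)
      simpa using F0
    · refine (hd u hu).congr_of_eventuallyEq ?_
      filter_upwards [L.isClosed_lattice.isOpen_compl.mem_nhds hu] with z hz
      have : z ∉ L.lattice := hz
      simp [hF, this]
  refine ⟨F 0, fun u hu => ?_⟩
  have := FD.apply_eq_apply_of_bounded (IsZLattice.isCompact_range_of_periodic L.lattice _
    FD.continuous Fl).isBounded u 0
  rw [← this]; simp [hF, hu]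

/-! ### Basic properties of theta -/

lemma theta_eq (τ z : ℂ) : theta τ z =
    Complex.exp (2 * (Real.pi : ℂ) * Complex.I * τ / 8) * jacobiTheta₂ (z + τ / 2 + 1 / 2) τ := by
  unfold theta jacobiTheta₂
  congr 1
  refine tsum_congr fun m => ?_
  have : (-1 : ℂ) ^ m = Complex.exp (m * (Real.pi * Complex.I)) := by
    rw [Complex.exp_int_mul, Complex.exp_pi_mul_I]
  rw [this, jacobiTheta₂_term, ← Complex.exp_add]
  congr 1
  ring

lemma theta_differentiable (τ : ℂ) (hτ : 0 < τ.im) : Differentiable ℂ (theta τ) := by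
  have : theta τ = fun z => Complex.exp (2 * (Real.pi : ℂ) * Complex.I * τ / 8) *
      jacobiTheta₂ (z + τ / 2 + 1 / 2) τ := funext (theta_eq τ)
  rw [this]
  intro z
  refine DifferentiableAt.const_mul ?_ _
  exact DifferentiableAt.comp (g := fun z => jacobiTheta₂ z τ) (f := fun z => z + τ / 2 + 1 / 2) z
    (differentiableAt_jacobiTheta₂_fst _ hτ) (by fun_prop)

lemma theta_add_one (τ z : ℂ) : theta τ (z + 1) = theta τ z := by
  rw [theta_eq, theta_eq, ← jacobiTheta₂_add_left (z + τ / 2 + 1 / 2)]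
  ring_nf

lemma theta_add_tau (τ z : ℂ) : theta τ (z + τ) =
    -Complex.exp (-(2 * Real.pi * Complex.I * (z + τ))) * theta τ z := by
  rw [theta_eq, theta_eq]
  have : z + τ + τ / 2 + 1 / 2 = (z + τ / 2 + 1 / 2) + τ := by ring
  rw [this, jacobiTheta₂_add_left']
  have : Complex.exp (-Real.pi * Complex.I * (τ + 2 * (z + τ / 2 + 1 / 2))) =
      -Complex.exp (-(2 * Real.pi * Complex.I * (z + τ))) := by
    rw [show -Real.pi * Complex.I * (τ + 2 * (z + τ / 2 + 1 / 2)) =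
      -(2 * Real.pi * Complex.I * (z + τ)) - (Real.pi * Complex.I : ℂ) by ring,
      Complex.exp_sub, Complex.exp_pi_mul_I]
    ring
  rw [this]; ring

lemma theta_neg (τ z : ℂ) : theta τ (-z) = -Complex.exp (2 * Real.pi * Complex.I * z) * theta τ z := by
  have h1 : theta τ (-z) = theta τ (z - τ) := by
    rw [theta_eq, theta_eq, ← jacobiTheta₂_neg_left, ← jacobiTheta₂_add_left]
    ring_nf
  have h2 := theta_add_tau τ (z - τ)
  rw [sub_add_cancel] at h2
  rw [h1, h2, ← mul_assoc, neg_mul_neg, ← Complex.exp_add]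
  simp

lemma theta_zero (τ : ℂ) : theta τ 0 = 0 := by
  have := theta_neg τ 0
  simp at this
  exact self_eq_neg.mp this

lemma jacobiTheta₂_exists_ne (τ : ℂ) (hτ : 0 < τ.im) : ∃ z, jacobiTheta₂ z τ ≠ 0 := by
  by_contra! h
  have hs : ∀ x : ℝ, HasSum (fun n : ℤ => jacobiTheta₂_term n x τ) 0 := fun x => by
    have := hasSum_jacobiTheta₂_term x hτ
    rwa [h] at this
  have hn : ∀ (n : ℤ) (x : ℝ), ‖jacobiTheta₂_term n x τ‖ = ‖jacobiTheta₂_term n 0 τ‖ := by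
    intro n x
    rw [norm_jacobiTheta₂_term, norm_jacobiTheta₂_term]; simp
  have hsum : Summable fun n : ℤ => ‖jacobiTheta₂_term n 0 τ‖ :=
    ((summable_jacobiTheta₂_term_iff 0 τ).mpr hτ).norm
  have key := intervalIntegral.hasSum_integral_of_dominated_convergence (μ := MeasureTheory.volume)
    (a := 0) (b := 1) (F := fun (n : ℤ) (x : ℝ) => jacobiTheta₂_term n x τ) (f := fun _ => (0 : ℂ))
    (fun n _ => ‖jacobiTheta₂_term n 0 τ‖)
    (fun n => by
      apply Continuous.aestronglyMeasurable
      unfold jacobiTheta₂_term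
      fun_prop)
    (fun n => Filter.Eventually.of_forall fun x _ => (hn n x).le)
    (Filter.Eventually.of_forall fun x _ => hsum)
    (by simp)
    (Filter.Eventually.of_forall fun x _ => hs x)
  have hI : ∀ n : ℤ, n ≠ 0 → ∫ x in (0:ℝ)..1, jacobiTheta₂_term n x τ = 0 := by
    intro n hn
    have hc : (2 * Real.pi * Complex.I * n : ℂ) ≠ 0 := by
      simp [Real.pi_ne_zero, hn]
    have : ∀ x : ℝ, jacobiTheta₂_term n x τ =
        Complex.exp (Real.pi * Complex.I * n ^ 2 * τ) *
          Complex.exp (2 * Real.pi * Complex.I * n * x) := by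
      intro x
      rw [jacobiTheta₂_term, add_comm, Complex.exp_add]
    simp_rw [this]
    rw [intervalIntegral.integral_const_mul, integral_exp_mul_complex hc]
    have : Complex.exp (2 * Real.pi * Complex.I * n * (1 : ℝ)) = 1 := by
      rw [Complex.exp_eq_one_iff]; exact ⟨n, by push_cast; ring⟩
    rw [this]; simp
  have key2 := hasSum_single (f := fun n : ℤ => ∫ x in (0:ℝ)..1, jacobiTheta₂_term n x τ) 0
    (fun n hn => hI n hn)
  have := key.unique key2
  simp [jacobiTheta₂_term] at this

lemma theta_exists_ne (τ : ℂ) (hτ : 0 < τ.im) : ∃ z, theta τ z ≠ 0 := by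
  obtain ⟨z, hz⟩ := jacobiTheta₂_exists_ne τ hτ
  refine ⟨z - τ / 2 - 1 / 2, ?_⟩
  rw [theta_eq]
  refine mul_ne_zero (Complex.exp_ne_zero _) ?_
  convert hz using 2
  ring

/-! ### The product side -/

/-- The `q`-Pochhammer product. -/
def qProd (q x : ℂ) : ℂ := ∏' n : ℕ, (1 + -(q ^ n * x))

lemma qProd_summable {q : ℂ} (hq : ‖q‖ < 1) (x : ℂ) : Summable fun n : ℕ => ‖-(q ^ n * x)‖ := by
  simp only [norm_neg, norm_mul, norm_pow]
  exact (summable_geometric_of_lt_one (norm_nonneg _) hq).mul_right _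

lemma qProd_step {q : ℂ} (hq : ‖q‖ < 1) (x : ℂ) : qProd q x = (1 - x) * qProd q (q * x) := by
  unfold qProd
  rw [tprod_eq_zero_mul']
  · simp only [pow_succ, pow_zero, one_mul, mul_assoc]
    ring
  · have := multipliable_one_add_of_summable (qProd_summable hq (q * x))
    simpa only [pow_succ, mul_assoc] using this

lemma qProd_ne_zero {q : ℂ} (hq : ‖q‖ < 1) (x : ℂ) (h : ∀ n : ℕ, q ^ n * x ≠ 1) :
    qProd q x ≠ 0 := by
  unfold qProd
  refine tprod_one_add_ne_zero_of_summable (fun n hn => h n ?_) (qProd_summable hq x)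
  linear_combination -hn

lemma qProd_differentiable {q : ℂ} (hq : ‖q‖ < 1) : Differentiable ℂ (qProd q) := by
  have key : HasProdLocallyUniformlyOn (fun (n : ℕ) (x : ℂ) => 1 + -(q ^ n * x))
      (fun x => ∏' n : ℕ, (1 + -(q ^ n * x))) Set.univ := by
    apply hasProdLocallyUniformlyOn_of_forall_compact isOpen_univ
    intro K _ hcK
    obtain ⟨C, hC⟩ := hcK.isBounded.exists_norm_le
    refine ((summable_geometric_of_lt_one (norm_nonneg q) hq).mul_right
      C).hasProdUniformlyOn_nat_one_add hcK (.of_forall fun n x hx => ?_) (fun _ => by fun_prop)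
    simp only [norm_neg, norm_mul, norm_pow]
    exact mul_le_mul_of_nonneg_left (hC x hx) (by positivity)
  have := key.differentiableOn (.of_forall fun _ => by
    simpa [Finset.prod_fn] using DifferentiableOn.finsetProd (fun _ _ => by fun_prop)) isOpen_univ
  exact differentiableOn_univ.mp this

/-- `exp(2πi z)`. -/
def e1 (z : ℂ) : ℂ := Complex.exp (2 * Real.pi * Complex.I * z)

lemma e1_add (a b : ℂ) : e1 (a + b) = e1 a * e1 b := by
  unfold e1; rw [← Complex.exp_add]; ring_nf

lemma e1_neg (a : ℂ) : e1 (-a) = (e1 a)⁻¹ := by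
  unfold e1; rw [← Complex.exp_neg]; ring_nf

lemma e1_ne (a : ℂ) : e1 a ≠ 0 := Complex.exp_ne_zero _

lemma e1_one : e1 1 = 1 := by
  unfold e1; rw [mul_one, Complex.exp_two_pi_mul_I]

lemma e1_zero : e1 0 = 1 := by simp [e1]

lemma e1_hasDerivAt (z : ℂ) : HasDerivAt e1 (2 * Real.pi * Complex.I * e1 z) z := by
  have := ((hasDerivAt_id z).const_mul (2 * Real.pi * Complex.I)).cexp
  refine HasDerivAt.congr_deriv (f' := _) this ?_
  simp [e1, mul_comm]

lemma e1_differentiable : Differentiable ℂ e1 := fun z => (e1_hasDerivAt z).differentiableAt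

lemma e1_eq_one {z : ℂ} (h : e1 z = 1) : ∃ m : ℤ, z = m := by
  obtain ⟨n, hn⟩ := Complex.exp_eq_one_iff.mp h
  refine ⟨n, ?_⟩
  have := Complex.two_pi_I_ne_zero
  refine mul_left_cancel₀ this ?_
  rw [hn]; ring

lemma e1_pow (n : ℕ) (z : ℂ) : e1 z ^ n = e1 (n * z) := by
  unfold e1; rw [← Complex.exp_nat_mul]; ring_nf

lemma norm_e1_lt (τ : ℂ) (hτ : 0 < τ.im) : ‖e1 τ‖ < 1 := by
  unfold e1
  rw [Complex.norm_exp, Real.exp_lt_one_iff]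
  simp
  positivity

/-- The triple product, up to a constant. -/
def thetaProd (τ z : ℂ) : ℂ :=
  (1 - e1 (-z)) * qProd (e1 τ) (e1 τ * e1 z) * qProd (e1 τ) (e1 τ * e1 (-z))

lemma thetaProd_add_one (τ z : ℂ) : thetaProd τ (z + 1) = thetaProd τ z := by
  simp [thetaProd, e1_add, e1_neg, e1_one]

lemma thetaProd_add_tau (τ : ℂ) (hτ : 0 < τ.im) (z : ℂ) : thetaProd τ (z + τ) =
    -e1 (-(z + τ)) * thetaProd τ z := by
  have hq := norm_e1_lt τ hτ
  have s1 := qProd_step hq (e1 τ * e1 z)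
  have s2 := qProd_step hq (e1 (-z))
  have hz := e1_ne z
  have ht := e1_ne τ
  unfold thetaProd
  have a1 : e1 τ * e1 (z + τ) = e1 τ * (e1 τ * e1 z) := by rw [e1_add]; ring
  have a2 : e1 τ * e1 (-(z + τ)) = e1 (-z) := by
    rw [neg_add, e1_add, e1_neg τ]; field_simp
  rw [a1, a2, s2, s1, neg_add, e1_add, e1_neg, e1_neg]
  field_simp
  ring

lemma thetaProd_ne_zero (τ : ℂ) (hτ : 0 < τ.im) (z : ℂ) (hz : z ∉ latticeGamma τ) :
    thetaProd τ z ≠ 0 := by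
  have hq := norm_e1_lt τ hτ
  refine mul_ne_zero (mul_ne_zero ?_ ?_) ?_
  · intro h
    obtain ⟨m, hm⟩ := e1_eq_one (sub_eq_zero.mp h).symm
    exact hz ⟨-m, 0, by push_cast; linear_combination -hm⟩
  · refine qProd_ne_zero hq _ fun n hn => ?_
    rw [e1_pow, ← e1_add, ← e1_add] at hn
    obtain ⟨m, hm⟩ := e1_eq_one hn
    exact hz ⟨m, -(n + 1), by push_cast; linear_combination hm⟩
  · refine qProd_ne_zero hq _ fun n hn => ?_
    rw [e1_pow, ← e1_add, ← e1_add] at hn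
    obtain ⟨m, hm⟩ := e1_eq_one hn
    exact hz ⟨-m, (n + 1), by push_cast; linear_combination -hm⟩

lemma thetaProd_differentiable (τ : ℂ) (hτ : 0 < τ.im) : Differentiable ℂ (thetaProd τ) := by
  have hA := qProd_differentiable (norm_e1_lt τ hτ)
  have he := e1_differentiable
  unfold thetaProd
  fun_prop

lemma thetaProd_zero (τ : ℂ) : thetaProd τ 0 = 0 := by simp [thetaProd, e1_zero]

lemma thetaProd_deriv_zero (τ : ℂ) (hτ : 0 < τ.im) : deriv (thetaProd τ) 0 ≠ 0 := by
  have hA := qProd_differentiable (norm_e1_lt τ hτ)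
  have he := e1_differentiable
  have hq := norm_e1_lt τ hτ
  set B : ℂ → ℂ := fun z => qProd (e1 τ) (e1 τ * e1 z) * qProd (e1 τ) (e1 τ * e1 (-z)) with hB
  have hBd : DifferentiableAt ℂ B 0 := by
    have : Differentiable ℂ B := by rw [hB]; fun_prop
    exact this 0
  have h0 : qProd (e1 τ) (e1 τ) ≠ 0 := by
    refine qProd_ne_zero hq _ fun n hn => ?_
    have := congrArg norm hn
    rw [← pow_succ, norm_pow, norm_one] at this
    have h3 := pow_lt_one₀ (norm_nonneg _) hq (Nat.succ_ne_zero n)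
    exact h3.ne this
  have hc : HasDerivAt (fun z => 1 - e1 (-z)) (2 * Real.pi * Complex.I) 0 := by
    have h1 : HasDerivAt e1 (2 * Real.pi * Complex.I) (-0) := by
      have := e1_hasDerivAt 0
      simpa [e1_zero] using this
    have h2 := (h1.comp (0 : ℂ) (hasDerivAt_neg (0 : ℂ))).const_sub 1
    simpa [Function.comp_def] using h2
  have h := hc.mul hBd.hasDerivAt
  have e : thetaProd τ = (fun z => 1 - e1 (-z)) * B := by
    funext z; simp [thetaProd, hB, mul_assoc]
  rw [e, h.deriv]
  simp [e1_zero, hB, h0, Real.pi_ne_zero]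

/-! ### Zeros of theta -/

open Topology Filter

lemma dslope_entire {f : ℂ → ℂ} (hf : Differentiable ℂ f) (a : ℂ) :
    Differentiable ℂ (dslope f a) :=
  differentiableOn_univ.mp
    ((Complex.differentiableOn_dslope Filter.univ_mem).mpr hf.differentiableOn)

lemma eq_mul_dslope {f : ℂ → ℂ} (h0 : f 0 = 0) (z : ℂ) : f z = z * dslope f 0 z := by
  have := sub_smul_dslope f 0 z
  simp [h0] at this
  exact this.symm

lemma theta_add_tau' (τ z : ℂ) : theta τ (z + τ) = -e1 (-(z + τ)) * theta τ z := by
  rw [theta_add_tau, e1, mul_neg]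

lemma theta_neg' (τ z : ℂ) : theta τ (-z) = -e1 z * theta τ z := theta_neg τ z

lemma theta_eq_prod (τ : ℂ) (hτ : 0 < τ.im) :
    ∃ c : ℂ, c ≠ 0 ∧ ∀ z, theta τ z = c * thetaProd τ z := by
  have ht := theta_differentiable τ hτ
  have hp := thetaProd_differentiable τ hτ
  obtain ⟨c, hc⟩ := ell_liouville τ hτ (fun z => theta τ z / thetaProd τ z)
    (fun z => dslope (theta τ) 0 z / dslope (thetaProd τ) 0 z)
    (fun u hu => by simp only [theta_add_one, thetaProd_add_one])
    (fun u hu => by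
      simp only [theta_add_tau', thetaProd_add_tau τ hτ]
      exact mul_div_mul_left _ _ (neg_ne_zero.mpr (e1_ne _)))
    (fun u hu => (ht u).div (hp u) (thetaProd_ne_zero τ hτ u hu))
    ((dslope_entire ht 0 0).div (dslope_entire hp 0 0) (by
      rw [dslope_same]; exact thetaProd_deriv_zero τ hτ))
    (by
      filter_upwards [self_mem_nhdsWithin] with u hu
      rw [eq_mul_dslope (theta_zero τ) u, eq_mul_dslope (thetaProd_zero τ) u]
      exact mul_div_mul_left _ _ hu)
  have hall : ∀ z, theta τ z = c * thetaProd τ z := by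
    have hoff : ∀ z, z ∉ latticeGamma τ → theta τ z = c * thetaProd τ z := fun z hz => by
      rw [← hc z hz, div_mul_cancel₀ _ (thetaProd_ne_zero τ hτ z hz)]
    have hlat : ∀ z, z ∈ latticeGamma τ → theta τ z = c * thetaProd τ z := by
      intro z hz
      have hcont : Continuous fun z => theta τ z - c * thetaProd τ z :=
        ht.continuous.sub (hp.continuous.const_mul c)
      have hev : ∀ᶠ u in 𝓝[≠] z, theta τ u - c * thetaProd τ u = 0 := by
        filter_upwards [self_mem_nhdsWithin, nhdsWithin_le_nhds
          ((ellPair τ hτ).compl_lattice_sdiff_singleton_mem_nhds z)] with u hu hu'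
        rw [hoff u, sub_self]
        intro h
        exact hu' ⟨(mem_ellPair τ hτ u).mpr h, hu⟩
      have l1 := (hcont.tendsto z).mono_left (nhdsWithin_le_nhds (s := {z}ᶜ))
      have l2 := (tendsto_const_nhds (x := (0 : ℂ)) (f := 𝓝[≠] z)).congr'
        (hev.mono fun _ h => h.symm)
      exact sub_eq_zero.mp (tendsto_nhds_unique l1 l2)
    intro z
    by_cases hz : z ∈ latticeGamma τ
    · exact hlat z hz
    · exact hoff z hz
  refine ⟨c, ?_, hall⟩
  rintro rfl
  obtain ⟨z, hz⟩ := theta_exists_ne τ hτ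
  exact hz (by rw [hall]; simp)

lemma theta_ne_zero (τ : ℂ) (hτ : 0 < τ.im) (z : ℂ) (hz : z ∉ latticeGamma τ) :
    theta τ z ≠ 0 := by
  obtain ⟨c, hc, h⟩ := theta_eq_prod τ hτ
  rw [h]
  exact mul_ne_zero hc (thetaProd_ne_zero τ hτ z hz)

lemma theta_deriv_zero (τ : ℂ) (hτ : 0 < τ.im) : deriv (theta τ) 0 ≠ 0 := by
  obtain ⟨c, hc, h⟩ := theta_eq_prod τ hτ
  rw [show theta τ = fun z => c * thetaProd τ z from funext h,
    deriv_const_mul _ (thetaProd_differentiable τ hτ 0)]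
  exact mul_ne_zero hc (thetaProd_deriv_zero τ hτ)

/-! ### The key identity -/

lemma lattice_isOpen_compl (τ : ℂ) (hτ : 0 < τ.im) (u : ℂ) (hu : u ∉ latticeGamma τ) :
    ∀ᶠ z in 𝓝 u, z ∉ latticeGamma τ := by
  have hu' : u ∉ (ellPair τ hτ).lattice := fun h => hu ((mem_ellPair τ hτ u).mp h)
  filter_upwards [(ellPair τ hτ).isClosed_lattice.isOpen_compl.mem_nhds hu'] with z hz h
  exact hz ((mem_ellPair τ hτ z).mpr h)

lemma neg_notMem_lattice {τ w : ℂ} (hw : w ∉ latticeGamma τ) : -w ∉ latticeGamma τ := by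
  rintro ⟨m, n, h⟩
  exact hw ⟨-m, -n, by push_cast; linear_combination -h⟩

lemma theta_deriv_differentiable (τ : ℂ) (hτ : 0 < τ.im) : Differentiable ℂ (deriv (theta τ)) :=
  (theta_differentiable τ hτ).deriv

lemma E1_add_one (τ z : ℂ) : E1 τ (z + 1) = E1 τ z := by
  have : deriv (theta τ) (z + 1) = deriv (theta τ) z := by
    rw [← deriv_comp_add_const]
    congr 1
    funext x
    exact theta_add_one τ x
  rw [E1, E1, this, theta_add_one]

lemma E1_add_tau (τ : ℂ) (hτ : 0 < τ.im) (z : ℂ) (hz : z ∉ latticeGamma τ) :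
    E1 τ (z + τ) = E1 τ z - 2 * Real.pi * Complex.I := by
  have hk : HasDerivAt (fun z => -e1 (-(z + τ)))
      (2 * Real.pi * Complex.I * e1 (-(z + τ))) z := by
    have h1 := (e1_hasDerivAt (-(z + τ))).comp z ((hasDerivAt_id z).add_const τ).neg
    have h2 := h1.neg
    refine HasDerivAt.congr_deriv (f' := _) h2 ?_
    ring
  have hd := hk.mul (theta_differentiable τ hτ z).hasDerivAt
  have : deriv (theta τ) (z + τ) = 2 * Real.pi * Complex.I * e1 (-(z + τ)) * theta τ z +
      -e1 (-(z + τ)) * deriv (theta τ) z := by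
    rw [← deriv_comp_add_const, ← hd.deriv]
    congr 1
    funext x
    exact theta_add_tau' τ x
  rw [E1, E1, this, theta_add_tau']
  have h1 := theta_ne_zero τ hτ z hz
  have h2 := e1_ne (-(z + τ))
  field_simp
  ring

lemma E2_add_one (τ z : ℂ) : E2 τ (z + 1) = E2 τ z := by
  rw [E2, E2, ← deriv_comp_add_const]
  congr 2
  funext x
  exact E1_add_one τ x

lemma E2_add_tau (τ : ℂ) (hτ : 0 < τ.im) (z : ℂ) (hz : z ∉ latticeGamma τ) :
    E2 τ (z + τ) = E2 τ z := by
  rw [E2, E2, ← deriv_comp_add_const]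
  congr 1
  rw [← deriv_sub_const (f := E1 τ) (2 * Real.pi * Complex.I)]
  apply Filter.EventuallyEq.deriv_eq
  filter_upwards [lattice_isOpen_compl τ hτ z hz] with x hx
  exact E1_add_tau τ hτ x hx

lemma E2_eq (τ : ℂ) (hτ : 0 < τ.im) (z : ℂ) (hz : z ∉ latticeGamma τ) :
    E2 τ z = -((deriv (deriv (theta τ)) z * theta τ z - deriv (theta τ) z ^ 2) / theta τ z ^ 2) := by
  have h := (theta_deriv_differentiable τ hτ z).hasDerivAt.div
    (theta_differentiable τ hτ z).hasDerivAt (theta_ne_zero τ hτ z hz)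
  have : E1 τ = deriv (theta τ) / theta τ := rfl
  rw [E2, this, h.deriv]
  ring

lemma theta_deriv_neg (τ : ℂ) (hτ : 0 < τ.im) (z : ℂ) : deriv (theta τ) (-z) =
    e1 z * (2 * Real.pi * Complex.I * theta τ z + deriv (theta τ) z) := by
  have hd := ((e1_hasDerivAt z).neg).mul (theta_differentiable τ hτ z).hasDerivAt
  have h1 : deriv (fun x => theta τ (-x)) z = -deriv (theta τ) (-z) := deriv_comp_neg _ _
  have h2 : (fun x => theta τ (-x)) = -e1 * theta τ := funext fun x => theta_neg' τ x
  rw [h2, hd.deriv] at h1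
  simp only [Pi.neg_apply] at h1
  linear_combination h1

lemma theta_deriv2_zero (τ : ℂ) (hτ : 0 < τ.im) : deriv (deriv (theta τ)) 0 =
    -(2 * Real.pi * Complex.I) * deriv (theta τ) 0 := by
  have hd := (e1_hasDerivAt 0).mul
    (((theta_differentiable τ hτ 0).hasDerivAt.const_mul (2 * Real.pi * Complex.I)).add
      (theta_deriv_differentiable τ hτ 0).hasDerivAt)
  have h1 : deriv (fun x => deriv (theta τ) (-x)) 0 = -deriv (deriv (theta τ)) (-0) :=
    deriv_comp_neg _ _
  have h2 : (fun x => deriv (theta τ) (-x)) =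
      e1 * ((fun x => 2 * Real.pi * Complex.I * theta τ x) + deriv (theta τ)) :=
    funext fun x => theta_deriv_neg τ hτ x
  rw [h2, hd.deriv] at h1
  simp only [Pi.add_apply, theta_zero, e1_zero, neg_zero] at h1
  linear_combination h1 / 2

/-- The numerator of the key elliptic function. -/
def keyNum (τ w u : ℂ) : ℂ :=
  deriv (theta τ) 0 ^ 2 / (theta τ w * theta τ (-w)) * (theta τ (u + w) * theta τ (u - w)) +
    (deriv (deriv (theta τ)) u * theta τ u - deriv (theta τ) u ^ 2)

lemma keyNum_differentiable (τ : ℂ) (hτ : 0 < τ.im) (w : ℂ) : Differentiable ℂ (keyNum τ w) := by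
  have h0 := theta_differentiable τ hτ
  have h1 := theta_deriv_differentiable τ hτ
  have h2 := h1.deriv
  unfold keyNum
  fun_prop

lemma keyNum_zero (τ : ℂ) (hτ : 0 < τ.im) (w : ℂ) (hw : w ∉ latticeGamma τ) :
    keyNum τ w 0 = 0 := by
  have h1 := theta_ne_zero τ hτ w hw
  have h2 := theta_ne_zero τ hτ (-w) (neg_notMem_lattice hw)
  simp only [keyNum, theta_zero, zero_add, zero_sub]
  field_simp
  ring

lemma keyNum_deriv_zero (τ : ℂ) (hτ : 0 < τ.im) (w : ℂ) (hw : w ∉ latticeGamma τ) :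
    deriv (keyNum τ w) 0 = 0 := by
  have n1 := theta_ne_zero τ hτ w hw
  have n2 := e1_ne w
  have h0 := theta_differentiable τ hτ
  have h1 := theta_deriv_differentiable τ hτ
  have h2 := h1.deriv
  have a1 : HasDerivAt (fun u => theta τ (u + w)) (deriv (theta τ) w) 0 := by
    have : HasDerivAt (theta τ) (deriv (theta τ) w) (0 + w) := by
      simpa using (h0 w).hasDerivAt
    exact this.comp_add_const 0 w
  have a2 : HasDerivAt (fun u => theta τ (u - w)) (deriv (theta τ) (-w)) 0 := by
    have : HasDerivAt (theta τ) (deriv (theta τ) (-w)) (0 - w) := by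
      simpa using (h0 (-w)).hasDerivAt
    exact this.comp_sub_const 0 w
  have hd := ((a1.mul a2).const_mul
    (deriv (theta τ) 0 ^ 2 / (theta τ w * theta τ (-w)))).add
    (((h2 0).hasDerivAt.mul (h0 0).hasDerivAt).sub ((h1 0).hasDerivAt.pow 2))
  refine (HasDerivAt.deriv (f := keyNum τ w) hd).trans ?_
  simp only [zero_add, zero_sub, theta_zero, theta_deriv2_zero τ hτ, theta_deriv_neg τ hτ w,
    theta_neg' τ w]
  field_simp
  ring

lemma key_identity (τ : ℂ) (hτ : 0 < τ.im) (w : ℂ) (hw : w ∉ latticeGamma τ) :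
    ∃ c, ∀ u, u ∉ latticeGamma τ → kronPhi τ u w * kronPhi τ u (-w) - E2 τ u = c := by
  have n1 := theta_ne_zero τ hτ w hw
  have n2 := theta_ne_zero τ hτ (-w) (neg_notMem_lattice hw)
  have hf : ∀ u, u ∉ latticeGamma τ → kronPhi τ u w * kronPhi τ u (-w) - E2 τ u =
      keyNum τ w u / theta τ u ^ 2 := by
    intro u hu
    have n3 := theta_ne_zero τ hτ u hu
    rw [E2_eq τ hτ u hu, kronPhi, kronPhi, keyNum, ← sub_eq_add_neg]
    field_simp
    ring
  have hD := keyNum_differentiable τ hτ w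
  have hT := theta_differentiable τ hτ
  refine ell_liouville τ hτ _
    (fun u => dslope (dslope (keyNum τ w) 0) 0 u / dslope (theta τ) 0 u ^ 2) ?_ ?_ ?_ ?_ ?_
  · intro u hu
    simp only [E2_add_one, kronPhi, add_right_comm u 1, theta_add_one]
  · intro u hu
    have n3 := theta_ne_zero τ hτ u hu
    simp only [E2_add_tau τ hτ u hu, kronPhi, add_right_comm u τ, theta_add_tau']
    congr 1
    have x1 := e1_ne u
    have x2 := e1_ne w
    have x3 := e1_ne τ
    simp only [neg_add, neg_neg, e1_add, e1_neg]
    field_simp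
  · intro u hu
    have : DifferentiableAt ℂ (fun u => keyNum τ w u / theta τ u ^ 2) u :=
      (hD u).div ((hT u).pow 2) (pow_ne_zero 2 (theta_ne_zero τ hτ u hu))
    refine this.congr_of_eventuallyEq ?_
    filter_upwards [lattice_isOpen_compl τ hτ u hu] with z hz
    exact hf z hz
  · refine (dslope_entire (dslope_entire hD 0) 0 0).div ((dslope_entire hT 0 0).pow 2) ?_
    rw [dslope_same]
    exact pow_ne_zero 2 (theta_deriv_zero τ hτ)
  · filter_upwards [self_mem_nhdsWithin, nhdsWithin_le_nhds
      ((ellPair τ hτ).compl_lattice_sdiff_singleton_mem_nhds 0)] with u hu hu'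
    have hu2 : u ∉ latticeGamma τ := fun h => hu' ⟨(mem_ellPair τ hτ u).mpr h, hu⟩
    have hu0 : u ≠ 0 := hu
    rw [hf u hu2, eq_mul_dslope (theta_zero τ) u, eq_mul_dslope (keyNum_zero τ hτ w hw) u,
      eq_mul_dslope (f := dslope (keyNum τ w) 0) (by
        rw [dslope_same]; exact keyNum_deriv_zero τ hτ w hw) u, mul_pow, ← mul_assoc, ← sq]
    exact mul_div_mul_left _ _ (pow_ne_zero 2 hu0)

lemma om_notMem (τ : ℂ) (hτ : 0 < τ.im) (N : ℕ) (hN : 2 ≤ N) (γ : ℤ × ℤ) (hγ : γ ∈ GammaN' N) :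
    om N τ γ ∉ latticeGamma τ := by
  rintro ⟨m, n, h⟩
  have hN0 : (N : ℂ) ≠ 0 := by exact_mod_cast (by omega : N ≠ 0)
  rw [om, div_eq_iff hN0] at h
  have him := congrArg Complex.im h
  have hre := congrArg Complex.re h
  simp at him hre
  have i2 : (γ.2 : ℝ) = n * N := by
    apply mul_right_cancel₀ hτ.ne'
    linear_combination him
  have i1 : (γ.1 : ℝ) = m * N := by
    linear_combination hre - τ.re * i2
  have j2 : γ.2 = n * N := by exact_mod_cast i2
  have j1 : γ.1 = m * N := by exact_mod_cast i1
  rw [GammaN', Finset.mem_sdiff, Finset.mem_image, Finset.mem_singleton] at hγ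
  obtain ⟨⟨p, hp, rfl⟩, hne⟩ := hγ
  simp only [Finset.mem_product, Finset.mem_range] at hp
  have k1 : p.1 = 0 := by
    refine Nat.eq_zero_of_dvd_of_lt ?_ hp.1
    exact Int.natCast_dvd_natCast.mp ⟨m, by rw [mul_comm]; exact j1⟩
  have k2 : p.2 = 0 := by
    refine Nat.eq_zero_of_dvd_of_lt ?_ hp.2
    exact Int.natCast_dvd_natCast.mp ⟨n, by rw [mul_comm]; exact j2⟩
  exact hne (by simp [k1, k2])

/-- **Section 3.2** (stationary reduction of the 2-site chiral flow to the elliptic top):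
`[A, φ̂_w(φ̂_{−w}(A))] = [A, ℘̂(A)]` for every `A = ∑_{γ∈Γ'_N} A_γ T_γ ∈ sl(N,ℂ)`. -/
theorem stationary_reduction_elliptic_top
    (τ : ℂ) (hτ : 0 < τ.im) (N : ℕ) (hN : 2 ≤ N)
    (w : ℂ) (hw : w ∉ latticeGamma τ)
    (A : (ℤ × ℤ) → ℂ) :
    ((∑ γ ∈ GammaN' N, A γ • Tm N γ)
          * (∑ γ ∈ GammaN' N, (A γ * phiG N τ γ w * phiG N τ γ (-w)) • Tm N γ)
        - (∑ γ ∈ GammaN' N, (A γ * phiG N τ γ w * phiG N τ γ (-w)) • Tm N γ)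
          * (∑ γ ∈ GammaN' N, A γ • Tm N γ))
      = ((∑ γ ∈ GammaN' N, A γ • Tm N γ)
            * (∑ γ ∈ GammaN' N, (A γ * wp τ (om N τ γ)) • Tm N γ)
          - (∑ γ ∈ GammaN' N, (A γ * wp τ (om N τ γ)) • Tm N γ)
            * (∑ γ ∈ GammaN' N, A γ • Tm N γ)) := by
  obtain ⟨c, hc⟩ := key_identity τ hτ w hw
  have h : ∀ γ ∈ GammaN' N, (A γ * phiG N τ γ w * phiG N τ γ (-w)) • Tm N γ =
      (A γ * wp τ (om N τ γ)) • Tm N γ + (c + 2 * eta1 τ) • (A γ • Tm N γ) := by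
    intro γ hγ
    have h1 := hc _ (om_notMem τ hτ N hN γ hγ)
    have h2 : eN N ((γ.2 : ℂ) * w) * eN N ((γ.2 : ℂ) * -w) = 1 := by
      rw [eN, eN, ← Complex.exp_add]
      rw [show 2 * (Real.pi : ℂ) * Complex.I * ((γ.2 : ℂ) * w) / N +
        2 * (Real.pi : ℂ) * Complex.I * ((γ.2 : ℂ) * -w) / N = 0 by ring, Complex.exp_zero]
    rw [smul_smul, ← add_smul]
    congr 1
    rw [phiG, phiG, wp]
    linear_combination A γ * h1 +
      A γ * kronPhi τ (om N τ γ) w * kronPhi τ (om N τ γ) (-w) * h2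
  rw [Finset.sum_congr rfl h, Finset.sum_add_distrib, ← Finset.smul_sum, mul_add, add_mul,
    mul_smul_comm, smul_mul_assoc]
  abel

end
end

section
/- Second flows of the 1+1 rational sl(2) Gaudin magnet (equations (q15)–(q16) of Section 4.1): Let z₁,…,z_n ∈ ℂ be pairwise distinct, fix a ∈ {1,…,n}, k ∈ ℂ, and nonzero constants λ₁,…,λ_n ∈ ℂ. Let S^c : ℝ² → Mat₂(ℂ) be twice continuously differentiable traceless matrix functions of (x,t) with (S^c(x,t))² = λ_c² · Id for all (x,t). Define H_a(x,t) = −(1/2) ∑_{c≠a} tr(S^a S^c)/(z_a − z_c), η^a = −(k/(4λ_a²)) [S^a, ∂_x S^a] + ∑_{c≠a} S^c/(z_a − z_c) + (H_a/λ_a²) S^a, L(x,t,z) = ∑_{c=1}^n S^c/(z − z_c) and M̃_a(x,t,z) = S^a/(z − z_a)² + η^a/(z − z_a). Then the zero-curvature equation ∂_t L − k ∂_x M̃_a = [L, M̃_a] holds for all (x,t) and all z ∈ ℂ ∖ {z₁,…,z_n}, if and only if for all (x,t): ∂_t S^a − k ∂_x η^a = [∑_{c≠a} S^c/(z_a − z_c),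 η^a] + ∑_{c≠a} [S^a, S^c]/(z_a − z_c)² and ∂_t S^b = [S^b, S^a]/(z_a − z_b)² + [η^a, S^b]/(z_a − z_b) for every b ≠ a. -/
open scoped BigOperators
open Matrix Finset

noncomputable section

/-- Entrywise partial derivative in the first (space) variable. -/
def mdx {N : ℕ} (S : ℝ → ℝ → Matrix (Fin N) (Fin N) ℂ) (x t : ℝ) :
    Matrix (Fin N) (Fin N) ℂ :=
  Matrix.of fun i j => deriv (fun x' => S x' t i j) x

/-- Entrywise partial derivative in the second (time) variable. -/
def mdt {N : ℕ} (S : ℝ → ℝ → Matrix (Fin N) (Fin N) ℂ) (x t : ℝ) :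
    Matrix (Fin N) (Fin N) ℂ :=
  Matrix.of fun i j => deriv (fun t' => S x t' i j) t

/-- The Gaudin Hamiltonian density `H_a(x,t) = −(1/2)∑_{c≠a} tr(S^aS^c)/(z_a−z_c)`. -/
def HamR {n : ℕ} (z : Fin n → ℂ) (S : Fin n → ℝ → ℝ → Matrix (Fin 2) (Fin 2) ℂ)
    (a : Fin n) (x t : ℝ) : ℂ :=
  -(1 / 2) * ∑ c ∈ Finset.univ.filter (fun c => c ≠ a),
      Matrix.trace (S a x t * S c x t) / (z a - z c)

/-- `η^a = −(k/(4λ_a²))[S^a, ∂_x S^a] + ∑_{c≠a} S^c/(z_a−z_c) + (H_a/λ_a²) S^a`. -/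
def etaR {n : ℕ} (k : ℂ) (lam : Fin n → ℂ) (z : Fin n → ℂ)
    (S : Fin n → ℝ → ℝ → Matrix (Fin 2) (Fin 2) ℂ) (a : Fin n) (x t : ℝ) :
    Matrix (Fin 2) (Fin 2) ℂ :=
  (-(k / (4 * lam a ^ 2))) • (S a x t * mdx (S a) x t - mdx (S a) x t * S a x t)
    + (∑ c ∈ Finset.univ.filter (fun c => c ≠ a), (z a - z c)⁻¹ • S c x t)
    + (HamR z S a x t / lam a ^ 2) • S a x t

lemma gaudin_pf_zero {n : ℕ} (z : Fin n → ℂ) (hz : ∀ a c : Fin n, a ≠ c → z a ≠ z c)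
    (A : Fin n → ℂ)
    (h : ∀ w : ℂ, (∀ c, w ≠ z c) → ∑ c, (w - z c)⁻¹ * A c = 0) (b : Fin n) : A b = 0 := by
  have hc : ContinuousAt (fun w : ℂ => A b + ∑ c ∈ Finset.univ.filter (fun c => c ≠ b),
      (w - z b) * ((w - z c)⁻¹ * A c)) (z b) := by
    refine ContinuousAt.add continuousAt_const ?_
    refine tendsto_finsetSum _ fun c hc => ?_
    have hne : z b - z c ≠ 0 := sub_ne_zero.2 (hz b c (by simpa using (Finset.mem_filter.1 hc).2.symm))
    have : ContinuousAt (fun w : ℂ => (w - z b) * ((w - z c)⁻¹ * A c)) (z b) := by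
      fun_prop (disch := exact hne)
    exact this
  have hlim := hc.tendsto.mono_left (nhdsWithin_le_nhds (s := {z b}ᶜ))
  have hev : ∀ᶠ w in nhdsWithin (z b) {z b}ᶜ, A b + ∑ c ∈ Finset.univ.filter (fun c => c ≠ b),
      (w - z b) * ((w - z c)⁻¹ * A c) = 0 := by
    have h1 : ∀ᶠ w in nhdsWithin (z b) {z b}ᶜ, ∀ c, w ≠ z c := by
      rw [Filter.eventually_all]
      intro c
      by_cases hcb : c = b
      · subst hcb; exact self_mem_nhdsWithin
      · exact Filter.Eventually.filter_mono nhdsWithin_le_nhds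
          (isOpen_ne.mem_nhds (hz b c (Ne.symm hcb)))
    filter_upwards [h1] with w hw
    have h2 := h w hw
    rw [← Finset.add_sum_erase _ _ (Finset.mem_univ b)] at h2
    have h3 : Finset.univ.filter (fun c => c ≠ b) = Finset.univ.erase b := by ext; simp
    rw [h3, ← Finset.mul_sum]
    have h4 : w - z b ≠ 0 := sub_ne_zero.2 (hw b)
    have h5 := congrArg (fun y => (w - z b) * y) h2
    simp only [mul_add, mul_zero] at h5
    rw [← mul_assoc, mul_inv_cancel₀ h4, one_mul] at h5
    exact h5
  have h0 := tendsto_nhds_unique (hlim.congr' hev) tendsto_const_nhds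
  simpa using h0

lemma gaudin_pf_zero_mat {n : ℕ} (z : Fin n → ℂ) (hz : ∀ a c : Fin n, a ≠ c → z a ≠ z c)
    (A : Fin n → Matrix (Fin 2) (Fin 2) ℂ)
    (h : ∀ w : ℂ, (∀ c, w ≠ z c) → ∑ c, (w - z c)⁻¹ • A c = 0) (b : Fin n) : A b = 0 := by
  ext i j
  refine gaudin_pf_zero z hz (fun c => A c i j) (fun w hw => ?_) b
  have := congrFun (congrFun (h w hw) i) j
  simpa [Matrix.sum_apply] using this

/-- Coefficients of the partial fraction expansion. -/
def gaudinCoef {n : ℕ} (z : Fin n → ℂ) (k : ℂ) (a : Fin n)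
    (S D : Fin n → Matrix (Fin 2) (Fin 2) ℂ) (E F : Matrix (Fin 2) (Fin 2) ℂ) (b : Fin n) :
    Matrix (Fin 2) (Fin 2) ℂ :=
  if b = a then
    (D a - k • F) - (((∑ c ∈ Finset.univ.filter (fun c => c ≠ a), (z a - z c)⁻¹ • S c) * E
      - E * (∑ c ∈ Finset.univ.filter (fun c => c ≠ a), (z a - z c)⁻¹ • S c))
      + ∑ c ∈ Finset.univ.filter (fun c => c ≠ a),
                  ((z a - z c) ^ 2)⁻¹ • (S a * S c - S c * S a))
  else D b - (((z a - z b) ^ 2)⁻¹ • (S b * S a - S a * S b)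
                + (z a - z b)⁻¹ • (E * S b - S b * E))

lemma gaudin_alg {n : ℕ} (z : Fin n → ℂ) (hz : ∀ a c : Fin n, a ≠ c → z a ≠ z c) (k : ℂ)
    (a : Fin n) (S D : Fin n → Matrix (Fin 2) (Fin 2) ℂ) (E F P' : Matrix (Fin 2) (Fin 2) ℂ)
    (hP : S a * E - E * S a = -(k • P')
      + ((S a * ∑ c ∈ Finset.univ.filter (fun c => c ≠ a), (z a - z c)⁻¹ • S c)
        - (∑ c ∈ Finset.univ.filter (fun c => c ≠ a), (z a - z c)⁻¹ • S c) * S a))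
    (w : ℂ) (hw : ∀ c, w ≠ z c) :
    (∑ c, (w - z c)⁻¹ • D c) - k • (((w - z a) ^ 2)⁻¹ • P' + (w - z a)⁻¹ • F)
      - ((∑ c, (w - z c)⁻¹ • S c) * (((w - z a) ^ 2)⁻¹ • S a + (w - z a)⁻¹ • E)
         - (((w - z a) ^ 2)⁻¹ • S a + (w - z a)⁻¹ • E) * (∑ c, (w - z c)⁻¹ • S c))
      = ∑ c, (w - z c)⁻¹ • gaudinCoef z k a S D E F c := by
  have h3 : Finset.univ.filter (fun c => c ≠ a) = Finset.univ.erase a := by ext; simp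
  rw [h3] at hP
  have hE : ∀ c ∈ Finset.univ.erase a, (w - z c)⁻¹ • gaudinCoef z k a S D E F c
      = (w - z c)⁻¹ • D c - (w - z c)⁻¹ • (((z a - z c) ^ 2)⁻¹ • (S c * S a - S a * S c)
                + (z a - z c)⁻¹ • (E * S c - S c * E)) := by
    intro c hc
    rw [gaudinCoef, if_neg (Finset.ne_of_mem_erase hc), smul_sub]
  rw [← Finset.add_sum_erase _ (fun c => (w - z c)⁻¹ • gaudinCoef z k a S D E F c)
    (Finset.mem_univ a), Finset.sum_congr rfl hE, Finset.sum_sub_distrib,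
    ← Finset.add_sum_erase _ (fun c => (w - z c)⁻¹ • D c) (Finset.mem_univ a),
    ← Finset.add_sum_erase _ (fun c => (w - z c)⁻¹ • S c) (Finset.mem_univ a)]
  rw [gaudinCoef, if_pos rfl, h3]
  set u := (w - z a)⁻¹ with hu
  have hu2 : ((w - z a) ^ 2)⁻¹ = u ^ 2 := by rw [hu, inv_pow]
  rw [hu2]
  have key : (∑ c ∈ Finset.univ.erase a, (w - z c)⁻¹ • S c) * (u ^ 2 • S a + u • E)
      - (u ^ 2 • S a + u • E) * (∑ c ∈ Finset.univ.erase a, (w - z c)⁻¹ • S c)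
      = u ^ 2 • ((∑ c ∈ Finset.univ.erase a, (z a - z c)⁻¹ • S c) * S a
          - S a * (∑ c ∈ Finset.univ.erase a, (z a - z c)⁻¹ • S c))
        + u • ((∑ c ∈ Finset.univ.erase a, (z a - z c)⁻¹ • S c) * E
          - E * (∑ c ∈ Finset.univ.erase a, (z a - z c)⁻¹ • S c))
        + u • (∑ c ∈ Finset.univ.erase a, ((z a - z c) ^ 2)⁻¹ • (S a * S c - S c * S a))
        + ∑ c ∈ Finset.univ.erase a, (w - z c)⁻¹ • (((z a - z c) ^ 2)⁻¹ • (S c * S a - S a * S c)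
                + (z a - z c)⁻¹ • (E * S c - S c * E)) := by
    simp only [Finset.sum_mul, Finset.mul_sum, Finset.smul_sum, ← Finset.sum_sub_distrib,
      ← Finset.sum_add_distrib]
    refine Finset.sum_congr rfl fun c hc => ?_
    have hac : z a - z c ≠ 0 := sub_ne_zero.2 (hz a c (Finset.ne_of_mem_erase hc).symm)
    have hwc : w - z c ≠ 0 := sub_ne_zero.2 (hw c)
    have hwa : w - z a ≠ 0 := sub_ne_zero.2 (hw a)
    have e1 : (w - z c)⁻¹ * u = (z a - z c)⁻¹ * u - (z a - z c)⁻¹ * (w - z c)⁻¹ := by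
      rw [hu]; field_simp; ring
    have e2 : (w - z c)⁻¹ * u ^ 2 = (z a - z c)⁻¹ * u ^ 2
        - ((z a - z c) ^ 2)⁻¹ * u + ((z a - z c) ^ 2)⁻¹ * (w - z c)⁻¹ := by
      rw [hu]; field_simp; ring
    have l : ((w - z c)⁻¹ • S c) * (u ^ 2 • S a + u • E)
      - (u ^ 2 • S a + u • E) * ((w - z c)⁻¹ • S c)
      = ((w - z c)⁻¹ * u ^ 2) • (S c * S a - S a * S c)
        + ((w - z c)⁻¹ * u) • (S c * E - E * S c) := by
      simp only [Matrix.smul_mul, Matrix.mul_smul, mul_add, add_mul]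
      module
    rw [l, e1, e2]
    simp only [Matrix.smul_mul, Matrix.mul_smul]
    module
  have key2 : ∀ X : Matrix (Fin 2) (Fin 2) ℂ,
      (u • S a + X) * (u ^ 2 • S a + u • E) - (u ^ 2 • S a + u • E) * (u • S a + X)
      = u ^ 2 • (S a * E - E * S a) + (X * (u ^ 2 • S a + u • E) - (u ^ 2 • S a + u • E) * X) := by
    intro X
    simp only [Matrix.smul_mul, Matrix.mul_smul, mul_add, add_mul]
    module
  rw [key2, key, hP]
  module

lemma mdx_hasDeriv {N : ℕ} (T : ℝ → ℝ → Matrix (Fin N) (Fin N) ℂ) (x t : ℝ)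
    (h : ∀ i j, DifferentiableAt ℝ (fun x' => T x' t i j) x) (i j : Fin N) :
    HasDerivAt (fun x' => T x' t i j) (mdx T x t i j) x := (h i j).hasDerivAt

lemma gaudin_mdx_anti (l : ℂ) (T : ℝ → ℝ → Matrix (Fin 2) (Fin 2) ℂ) (x t : ℝ)
    (h : ∀ i j, DifferentiableAt ℝ (fun x' => T x' t i j) x)
    (hsq : ∀ x t, T x t * T x t = (l ^ 2) • (1 : Matrix (Fin 2) (Fin 2) ℂ)) :
    T x t * mdx T x t + mdx T x t * T x t = 0 := by
  ext i j
  have hd := fun i j => mdx_hasDeriv T x t h i j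
  have h1 : HasDerivAt (fun x' => (T x' t * T x' t) i j)
      ((T x t * mdx T x t + mdx T x t * T x t) i j) x := by
    simp only [Matrix.mul_apply, Matrix.add_apply, Fin.sum_univ_two]
    refine HasDerivAt.congr_deriv
      (((hd i 0).mul (hd 0 j)).add ((hd i 1).mul (hd 1 j))) ?_
    ring
  have h2 : HasDerivAt (fun x' => (T x' t * T x' t) i j) 0 x := by
    simp only [hsq]
    exact hasDerivAt_const _ _
  simpa using h1.unique h2

lemma gaudin_hP {n : ℕ} (k : ℂ) (lam : Fin n → ℂ) (hlam : ∀ c, lam c ≠ 0) (z : Fin n → ℂ)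
    (S : Fin n → ℝ → ℝ → Matrix (Fin 2) (Fin 2) ℂ) (a : Fin n) (x t : ℝ)
    (hsq : S a x t * S a x t = (lam a ^ 2) • (1 : Matrix (Fin 2) (Fin 2) ℂ))
    (hanti : S a x t * mdx (S a) x t + mdx (S a) x t * S a x t = 0) :
    S a x t * etaR k lam z S a x t - etaR k lam z S a x t * S a x t = -(k • mdx (S a) x t)
      + ((S a x t * ∑ c ∈ Finset.univ.filter (fun c => c ≠ a), (z a - z c)⁻¹ • S c x t)
        - (∑ c ∈ Finset.univ.filter (fun c => c ≠ a), (z a - z c)⁻¹ • S c x t) * S a x t) := by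
  unfold etaR
  generalize (∑ c ∈ Finset.univ.filter (fun c => c ≠ a), (z a - z c)⁻¹ • S c x t) = X
  generalize HamR z S a x t = H
  generalize mdx (S a) x t = P' at *
  generalize S a x t = P at *
  have hl := hlam a
  have hb : P' * P = -(P * P') := by rw [eq_neg_iff_add_eq_zero, add_comm]; exact hanti
  have h1 : P * (P * P' - P' * P) - (P * P' - P' * P) * P = (4 * lam a ^ 2) • P' := by
    have e1 : P * (P * P') = lam a ^ 2 • P' := by rw [← mul_assoc, hsq]; simp
    have e2 : P * P' * P = -(lam a ^ 2 • P') := by rw [mul_assoc, hb, mul_neg, e1]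
    rw [hb, sub_neg_eq_add, mul_add, add_mul, e1, e2]
    module
  have h2 : P * ((-(k / (4 * lam a ^ 2))) • (P * P' - P' * P) + X + (H / lam a ^ 2) • P)
      - ((-(k / (4 * lam a ^ 2))) • (P * P' - P' * P) + X + (H / lam a ^ 2) • P) * P
      = (-(k / (4 * lam a ^ 2))) • (P * (P * P' - P' * P) - (P * P' - P' * P) * P)
        + (P * X - X * P) := by
    generalize P * P' - P' * P = Q
    simp only [Matrix.smul_mul, Matrix.mul_smul, mul_add, add_mul]
    module
  rw [h2, h1, smul_smul]
  have : -(k / (4 * lam a ^ 2)) * (4 * lam a ^ 2) = -k := by field_simp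
  rw [this, neg_smul]

lemma gaudin_diff_x (f : ℝ × ℝ → ℂ) (hf : ContDiff ℝ 2 f) (x t : ℝ) :
    DifferentiableAt ℝ (fun x' => f (x', t)) x := by
  have := hf.differentiable (by norm_num)
  fun_prop

lemma gaudin_diff_t (f : ℝ × ℝ → ℂ) (hf : ContDiff ℝ 2 f) (x t : ℝ) :
    DifferentiableAt ℝ (fun t' => f (x, t')) t := by
  have := hf.differentiable (by norm_num)
  fun_prop

lemma gaudin_diff_xx (f : ℝ × ℝ → ℂ) (hf : ContDiff ℝ 2 f) (x t : ℝ) :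
    DifferentiableAt ℝ (fun x' => deriv (fun y => f (y, t)) x') x := by
  have h : ContDiff ℝ 2 (fun y : ℝ => f (y, t)) := by fun_prop
  have h2 : ContDiff ℝ 1 (deriv (fun y : ℝ => f (y, t))) := by
    have := (contDiff_succ_iff_deriv (n := 1) (f := fun y : ℝ => f (y, t))).1 (by rw [one_add_one_eq_two]; exact h)
    exact this.2.2
  exact (h2.differentiable (by norm_num)) x

lemma gaudin_eta_diff {n : ℕ} (k : ℂ) (lam : Fin n → ℂ) (z : Fin n → ℂ)
    (S : Fin n → ℝ → ℝ → Matrix (Fin 2) (Fin 2) ℂ) (a : Fin n) (x t : ℝ)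
    (hS : ∀ c i j, ContDiff ℝ 2 (fun p : ℝ × ℝ => S c p.1 p.2 i j)) (i j : Fin 2) :
    DifferentiableAt ℝ (fun x' => etaR k lam z S a x' t i j) x := by
  have h1 : ∀ c i j, DifferentiableAt ℝ (fun x' => S c x' t i j) x := fun c i j =>
    gaudin_diff_x _ (hS c i j) x t
  have h2 : ∀ i j, DifferentiableAt ℝ (fun x' => mdx (S a) x' t i j) x := fun i j =>
    gaudin_diff_xx _ (hS a i j) x t
  simp only [etaR, HamR, Matrix.add_apply, Matrix.smul_apply, Matrix.sub_apply, Matrix.mul_apply,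
    Fin.sum_univ_two, Matrix.sum_apply, smul_eq_mul, Matrix.trace_fin_two, div_eq_mul_inv]
  fun_prop

/-- **Equations (q15)–(q16)** (second flows of the 1+1 rational sl(2) Gaudin magnet):
the zero-curvature equation `∂_t L − k ∂_x M̃_a = [L, M̃_a]` is equivalent to the stated
equations of motion. -/
theorem rational_sl2_gaudin_second_flow
    (n : ℕ) (z : Fin n → ℂ) (hz : ∀ a c : Fin n, a ≠ c → z a ≠ z c)
    (a : Fin n) (k : ℂ) (lam : Fin n → ℂ) (hlam : ∀ c, lam c ≠ 0)
    (S : Fin n → ℝ → ℝ → Matrix (Fin 2) (Fin 2) ℂ)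
    (hS : ∀ c i j, ContDiff ℝ 2 (fun p : ℝ × ℝ => S c p.1 p.2 i j))
    (htr : ∀ c x t, Matrix.trace (S c x t) = 0)
    (hsq : ∀ c x t, S c x t * S c x t = (lam c ^ 2) • (1 : Matrix (Fin 2) (Fin 2) ℂ)) :
    (∀ x t : ℝ, ∀ w : ℂ, (∀ c : Fin n, w ≠ z c) →
        mdt (fun x' t' => ∑ c : Fin n, (w - z c)⁻¹ • S c x' t') x t
          - k • mdx (fun x' t' =>
              ((w - z a) ^ 2)⁻¹ • S a x' t' + (w - z a)⁻¹ • etaR k lam z S a x' t') x t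
          = (∑ c : Fin n, (w - z c)⁻¹ • S c x t)
                * (((w - z a) ^ 2)⁻¹ • S a x t + (w - z a)⁻¹ • etaR k lam z S a x t)
              - (((w - z a) ^ 2)⁻¹ • S a x t + (w - z a)⁻¹ • etaR k lam z S a x t)
                * (∑ c : Fin n, (w - z c)⁻¹ • S c x t))
    ↔ ((∀ x t : ℝ,
          mdt (S a) x t - k • mdx (fun x' t' => etaR k lam z S a x' t') x t
            = ((∑ c ∈ Finset.univ.filter (fun c => c ≠ a), (z a - z c)⁻¹ • S c x t)
                    * etaR k lam z S a x t
                  - etaR k lam z S a x t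
                    * (∑ c ∈ Finset.univ.filter (fun c => c ≠ a), (z a - z c)⁻¹ • S c x t))
              + ∑ c ∈ Finset.univ.filter (fun c => c ≠ a),
                  ((z a - z c) ^ 2)⁻¹ • (S a x t * S c x t - S c x t * S a x t))
        ∧ (∀ x t : ℝ, ∀ b : Fin n, b ≠ a →
            mdt (S b) x t
              = ((z a - z b) ^ 2)⁻¹ • (S b x t * S a x t - S a x t * S b x t)
                + (z a - z b)⁻¹
                    • (etaR k lam z S a x t * S b x t - S b x t * etaR k lam z S a x t))) := by
  have hx : ∀ c x t i j, DifferentiableAt ℝ (fun x' => S c x' t i j) x := fun c x t i j =>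
    gaudin_diff_x _ (hS c i j) x t
  have ht : ∀ c x t i j, DifferentiableAt ℝ (fun t' => S c x t' i j) t := fun c x t i j =>
    gaudin_diff_t _ (hS c i j) x t
  have hη : ∀ x t i j, DifferentiableAt ℝ (fun x' => etaR k lam z S a x' t i j) x :=
    fun x t i j => gaudin_eta_diff k lam z S a x t hS i j
  have hL : ∀ x t w, mdt (fun x' t' => ∑ c : Fin n, (w - z c)⁻¹ • S c x' t') x t
      = ∑ c, (w - z c)⁻¹ • mdt (S c) x t := by
    intro x t w
    ext i j
    have : HasDerivAt (fun t' => ∑ c : Fin n, (w - z c)⁻¹ * S c x t' i j)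
        (∑ c : Fin n, (w - z c)⁻¹ * mdt (S c) x t i j) t :=
      HasDerivAt.fun_sum fun c _ => ((ht c x t i j).hasDerivAt).const_mul _
    simpa [mdt, Matrix.sum_apply] using this.deriv
  have hM : ∀ x t w, mdx (fun x' t' =>
      ((w - z a) ^ 2)⁻¹ • S a x' t' + (w - z a)⁻¹ • etaR k lam z S a x' t') x t
      = ((w - z a) ^ 2)⁻¹ • mdx (S a) x t
        + (w - z a)⁻¹ • mdx (fun x' t' => etaR k lam z S a x' t') x t := by
    intro x t w
    ext i j
    have := (((hx a x t i j).hasDerivAt).const_mul ((w - z a) ^ 2)⁻¹).add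
      (((hη x t i j).hasDerivAt).const_mul (w - z a)⁻¹)
    exact this.deriv
  have halg := fun x t w hw => gaudin_alg z hz k a (fun c => S c x t) (fun c => mdt (S c) x t)
    (etaR k lam z S a x t) (mdx (fun x' t' => etaR k lam z S a x' t') x t) (mdx (S a) x t)
    (gaudin_hP k lam hlam z S a x t (hsq a x t)
      (gaudin_mdx_anti (lam a) (S a) x t (hx a x t) (hsq a))) w hw
  simp only [hL, hM]
  constructor
  · intro h
    have h0 := fun x t => gaudin_pf_zero_mat z hz _
      (fun w hw => (halg x t w hw).symm.trans (sub_eq_zero.2 (h x t w hw)))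
    constructor
    · intro x t
      have := h0 x t a
      rw [gaudinCoef, if_pos rfl] at this
      exact sub_eq_zero.1 this
    · intro x t b hb
      have := h0 x t b
      rw [gaudinCoef, if_neg hb] at this
      exact sub_eq_zero.1 this
  · rintro ⟨ha, hb⟩ x t w hw
    refine sub_eq_zero.1 ((halg x t w hw).trans (Finset.sum_eq_zero fun c _ => ?_))
    by_cases hc : c = a
    · rw [gaudinCoef, if_pos hc, sub_eq_zero.2 (ha x t), smul_zero]
    · rw [gaudinCoef, if_neg hc, sub_eq_zero.2 (hb x t c hc), smul_zero]


end
end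

section
/- Density of the second Hamiltonian via the local expansion of the Riccati/Schrödinger potential (Lemma 4.2): Let k, λ ∈ ℂ with λ ≠ 0, and let L⁻¹, L⁰, L¹ : ℝ → Mat₂(ℂ) be traceless 2π-periodic matrix functions with L⁻¹ twice continuously differentiable, L⁰ continuously differentiable, L¹ continuous, L⁻¹₁₂(x) ≠ 0 for all x, and (L⁻¹₁₁(x))² + L⁻¹₁₂(x) L⁻¹₂₁(x) = λ² for all x. Define T_{a,−1}(x) = L⁻¹₁₂ L⁰₂₁ + L⁰₁₂ L⁻¹₂₁ + 2 L⁰₁₁ L⁻¹₁₁ + k L⁻¹₁₁ (∂_x L⁻¹₁₂)/L⁻¹₁₂ − k ∂_x L⁻¹₁₁ and T_{a,0}(x) = L¹₁₂ L⁻¹₂₁ + L⁻¹₁₂ L¹₂₁ + 2 L¹₁₁ L⁻¹₁₁ + L⁰₁₂ L⁰₂₁ + (L⁰₁₁)² + (k/L⁻¹₁₂)(L⁰₁₁ ∂_x L⁻¹₁₂ + L⁻¹₁₁ ∂_x L⁰₁₂ − L⁰₁₂ L⁻¹₁₁ (∂_x L⁻¹₁₂)/L⁻¹₁₂) − k ∂_x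 L⁰₁₁ − (k²/2)(∂_x² L⁻¹₁₂)/L⁻¹₁₂ + (3k²/4)((∂_x L⁻¹₁₂)/L⁻¹₁₂)². Then ∫₀^{2π} ( 4λ² T_{a,0} − T_{a,−1}² ) dx = ∫₀^{2π} [ 2 tr((L⁻¹)²) ( (1/2) tr((L⁰)²) + tr(L¹ L⁻¹) ) − ( tr(L⁻¹ L⁰) )² + 2k tr(L⁰ (∂_x L⁻¹) L⁻¹) − (k²/2) tr((∂_x L⁻¹)²) ] dx. -/
open scoped BigOperators
open Matrix MeasureTheory

noncomputable section

/-- Entrywise derivative of a matrix-valued function on `ℝ`. -/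
def mD (L : ℝ → Matrix (Fin 2) (Fin 2) ℂ) (x : ℝ) : Matrix (Fin 2) (Fin 2) ℂ :=
  Matrix.of fun i j => deriv (fun y => L y i j) x

/-- **Lemma 4.2** (density of the second Hamiltonian via the local expansion of the
Riccati/Schrödinger potential):
`∫₀^{2π} (4λ²T_{a,0} − T_{a,−1}²) dx` equals the corresponding invariant expression. -/
theorem second_hamiltonian_density
    (k lam : ℂ) (hlam : lam ≠ 0)
    (Lm1 L0 L1 : ℝ → Matrix (Fin 2) (Fin 2) ℂ)
    (hper1 : ∀ x, Lm1 (x + 2 * Real.pi) = Lm1 x)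
    (hper0 : ∀ x, L0 (x + 2 * Real.pi) = L0 x)
    (hperp : ∀ x, L1 (x + 2 * Real.pi) = L1 x)
    (htr1 : ∀ x, Matrix.trace (Lm1 x) = 0)
    (htr0 : ∀ x, Matrix.trace (L0 x) = 0)
    (htrp : ∀ x, Matrix.trace (L1 x) = 0)
    (hC1 : ∀ i j, ContDiff ℝ 2 (fun x => Lm1 x i j))
    (hC0 : ∀ i j, ContDiff ℝ 1 (fun x => L0 x i j))
    (hCp : ∀ i j, Continuous (fun x => L1 x i j))
    (hne : ∀ x, Lm1 x 0 1 ≠ 0)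
    (heig : ∀ x, (Lm1 x 0 0) ^ 2 + Lm1 x 0 1 * Lm1 x 1 0 = lam ^ 2) :
    (∫ x in (0 : ℝ)..(2 * Real.pi),
        (4 * lam ^ 2
            * (L1 x 0 1 * Lm1 x 1 0 + Lm1 x 0 1 * L1 x 1 0 + 2 * L1 x 0 0 * Lm1 x 0 0
                + L0 x 0 1 * L0 x 1 0 + (L0 x 0 0) ^ 2
                + (k / Lm1 x 0 1)
                    * (L0 x 0 0 * deriv (fun y => Lm1 y 0 1) x
                        + Lm1 x 0 0 * deriv (fun y => L0 y 0 1) x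
                        - L0 x 0 1 * Lm1 x 0 0 * deriv (fun y => Lm1 y 0 1) x / Lm1 x 0 1)
                - k * deriv (fun y => L0 y 0 0) x
                - (k ^ 2 / 2) * deriv (fun y => deriv (fun y' => Lm1 y' 0 1) y) x / Lm1 x 0 1
                + (3 * k ^ 2 / 4) * (deriv (fun y => Lm1 y 0 1) x / Lm1 x 0 1) ^ 2)
          - (Lm1 x 0 1 * L0 x 1 0 + L0 x 0 1 * Lm1 x 1 0 + 2 * L0 x 0 0 * Lm1 x 0 0
              + k * Lm1 x 0 0 * deriv (fun y => Lm1 y 0 1) x / Lm1 x 0 1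
              - k * deriv (fun y => Lm1 y 0 0) x) ^ 2))
      = ∫ x in (0 : ℝ)..(2 * Real.pi),
          (2 * Matrix.trace (Lm1 x * Lm1 x)
              * ((1 / 2) * Matrix.trace (L0 x * L0 x) + Matrix.trace (L1 x * Lm1 x))
            - (Matrix.trace (Lm1 x * L0 x)) ^ 2
            + 2 * k * Matrix.trace (L0 x * mD Lm1 x * Lm1 x)
            - (k ^ 2 / 2) * Matrix.trace (mD Lm1 x * mD Lm1 x)) := by
  have hd1 : ∀ i j x, HasDerivAt (fun y => Lm1 y i j) (deriv (fun y => Lm1 y i j) x) x :=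
    fun i j x => ((hC1 i j).differentiable (by norm_num) x).hasDerivAt
  have hd0 : ∀ i j x, HasDerivAt (fun y => L0 y i j) (deriv (fun y => L0 y i j) x) x :=
    fun i j x => ((hC0 i j).differentiable (by norm_num) x).hasDerivAt
  have hC1' : ∀ i j, ContDiff ℝ 1 (fun x => deriv (fun y => Lm1 y i j) x) := fun i j =>
    ((contDiff_succ_iff_deriv (n := 1)).1 (hC1 i j)).2.2
  have hd2 : ∀ i j x, HasDerivAt (fun y => deriv (fun y' => Lm1 y' i j) y)
      (deriv (fun y => deriv (fun y' => Lm1 y' i j) y) x) x :=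
    fun i j x => ((hC1' i j).differentiable (by norm_num) x).hasDerivAt
  have c1 : ∀ i j, Continuous (fun x => Lm1 x i j) := fun i j => (hC1 i j).continuous
  have c0 : ∀ i j, Continuous (fun x => L0 x i j) := fun i j => (hC0 i j).continuous
  have c1' : ∀ i j, Continuous (fun x => deriv (fun y => Lm1 y i j) x) :=
    fun i j => (hC1' i j).continuous
  have c0' : ∀ i j, Continuous (fun x => deriv (fun y => L0 y i j) x) :=
    fun i j => (hC0 i j).continuous_deriv (by norm_num)
  have c2 : ∀ i j, Continuous (fun x => deriv (fun y => deriv (fun y' => Lm1 y' i j) y) x) :=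
    fun i j => (hC1' i j).continuous_deriv (by norm_num)
  let G : ℝ → ℂ := fun x => 4 * lam ^ 2 * k * (Lm1 x 0 0 * L0 x 0 1 / Lm1 x 0 1 - L0 x 0 0)
    - 2 * lam ^ 2 * k ^ 2 * (deriv (fun y => Lm1 y 0 1) x / Lm1 x 0 1)
  let G' : ℝ → ℂ := fun x => 4 * lam ^ 2 * k *
      (((deriv (fun y => Lm1 y 0 0) x * L0 x 0 1 + Lm1 x 0 0 * deriv (fun y => L0 y 0 1) x)
          * Lm1 x 0 1 - Lm1 x 0 0 * L0 x 0 1 * deriv (fun y => Lm1 y 0 1) x) / Lm1 x 0 1 ^ 2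
        - deriv (fun y => L0 y 0 0) x)
    - 2 * lam ^ 2 * k ^ 2 * ((deriv (fun y => deriv (fun y' => Lm1 y' 0 1) y) x * Lm1 x 0 1
        - deriv (fun y => Lm1 y 0 1) x * deriv (fun y => Lm1 y 0 1) x) / Lm1 x 0 1 ^ 2)
  have hG : ∀ x, HasDerivAt G (G' x) x := fun x =>
    (((((hd1 0 0 x).mul (hd0 0 1 x)).div (hd1 0 1 x) (hne x)).sub (hd0 0 0 x)).const_mul _).sub
      (((hd2 0 1 x).div (hd1 0 1 x) (hne x)).const_mul _)
  have hG'c : Continuous G' := by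
    have hne2 : ∀ x, Lm1 x 0 1 ^ 2 ≠ 0 := fun x => pow_ne_zero 2 (hne x)
    refine Continuous.sub (continuous_const.mul (Continuous.sub (Continuous.div ?_ ((c1 0 1).pow 2) hne2) (c0' 0 0)))
      (continuous_const.mul (Continuous.div ?_ ((c1 0 1).pow 2) hne2))
    · exact ((((c1' 0 0).mul (c0 0 1)).add ((c1 0 0).mul (c0' 0 1))).mul (c1 0 1)).sub
        (((c1 0 0).mul (c0 0 1)).mul (c1' 0 1))
    · exact ((c2 0 1).mul (c1 0 1)).sub ((c1' 0 1).mul (c1' 0 1))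
  have hdper : deriv (fun y => Lm1 y 0 1) (2 * Real.pi) = deriv (fun y => Lm1 y 0 1) 0 := by
    have h := deriv_comp_add_const (fun y => Lm1 y 0 1) (2 * Real.pi) 0
    simp only [hper1, zero_add] at h
    exact h.symm
  have hGint : ∫ x in (0 : ℝ)..(2 * Real.pi), G' x = 0 := by
    rw [intervalIntegral.integral_eq_sub_of_hasDerivAt (fun x _ => hG x)
      (hG'c.intervalIntegrable _ _)]
    have h1 := hper1 0
    have h0 := hper0 0
    rw [zero_add] at h1 h0
    simp only [G, hdper, h1, h0, sub_self]
  have t1 : ∀ x, Lm1 x 1 1 = - Lm1 x 0 0 := fun x => by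
    have h := htr1 x
    rw [Matrix.trace_fin_two] at h
    linear_combination h
  have t0 : ∀ x, L0 x 1 1 = - L0 x 0 0 := fun x => by
    have h := htr0 x
    rw [Matrix.trace_fin_two] at h
    linear_combination h
  have tp : ∀ x, L1 x 1 1 = - L1 x 0 0 := fun x => by
    have h := htrp x
    rw [Matrix.trace_fin_two] at h
    linear_combination h
  have t1' : ∀ x, deriv (fun y => Lm1 y 1 1) x = - deriv (fun y => Lm1 y 0 0) x := fun x => by
    simp only [t1]
    exact (hd1 0 0 x).neg.deriv
  have heig' : ∀ x, 2 * Lm1 x 0 0 * deriv (fun y => Lm1 y 0 0) x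
      + (deriv (fun y => Lm1 y 0 1) x * Lm1 x 1 0
        + Lm1 x 0 1 * deriv (fun y => Lm1 y 1 0) x) = 0 := fun x => by
    have h := (((hd1 0 0 x).mul (hd1 0 0 x)).add ((hd1 0 1 x).mul (hd1 1 0 x)))
    have h2 : HasDerivAt (fun _ : ℝ => lam ^ 2) 0 x := hasDerivAt_const _ _
    have h3 := h.unique (h2.congr_of_eventuallyEq (Filter.Eventually.of_forall fun y => by
      have := heig y
      simp only [Pi.add_apply, Pi.mul_apply]
      linear_combination this))
    linear_combination h3
  let g : ℝ → ℂ := fun x => (2 * Matrix.trace (Lm1 x * Lm1 x)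
              * ((1 / 2) * Matrix.trace (L0 x * L0 x) + Matrix.trace (L1 x * Lm1 x))
            - (Matrix.trace (Lm1 x * L0 x)) ^ 2
            + 2 * k * Matrix.trace (L0 x * mD Lm1 x * Lm1 x)
            - (k ^ 2 / 2) * Matrix.trace (mD Lm1 x * mD Lm1 x))
  have hgc : Continuous g := by
    have m1 : Continuous Lm1 := continuous_matrix c1
    have m0 : Continuous L0 := continuous_matrix c0
    have mp : Continuous L1 := continuous_matrix hCp
    have md : Continuous (mD Lm1) := continuous_matrix c1'
    fun_prop
  have key : (∫ x in (0 : ℝ)..(2 * Real.pi), (g x + G' x))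
      = ∫ x in (0 : ℝ)..(2 * Real.pi), g x := by
    rw [intervalIntegral.integral_add (hgc.intervalIntegrable _ _)
      (hG'c.intervalIntegrable _ _), hGint, add_zero]
  refine Eq.trans (intervalIntegral.integral_congr fun x _ => ?_) key
  have hb := hne x
  have e := heig x
  have e' := heig' x
  simp only [g, G', Matrix.trace_fin_two, Matrix.mul_apply, Fin.sum_univ_two, mD, Matrix.of_apply,
    t1']
  simp only [t1, t0, tp]
  generalize deriv (fun y => deriv (fun y' => Lm1 y' 0 1) y) x = b2
  generalize deriv (fun y => Lm1 y 0 0) x = a1 at *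
  generalize deriv (fun y => Lm1 y 0 1) x = b1 at *
  generalize deriv (fun y => Lm1 y 1 0) x = d1 at *
  generalize deriv (fun y => L0 y 0 1) x = q1
  generalize deriv (fun y => L0 y 0 0) x = p1
  generalize Lm1 x 0 0 = a at *
  generalize Lm1 x 0 1 = b at *
  generalize Lm1 x 1 0 = c at *
  have hc : c = (lam ^ 2 - a ^ 2) / b := by
    field_simp
    linear_combination e
  have hd : d1 = -(2 * a * a1 + b1 * c) / b := by
    field_simp
    linear_combination e'
  subst hd
  subst hc
  field_simp
  ring

end
end
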